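/- arXiv:2202.10946 — 8 statements merged into one kernel-verified Lean document; each statement's English description precedes it below -/
import Mathlib

section
/- Let G = (N, E) be an undirected graph on the set of agents, and suppose some connected component of G has a vertex cover C of size k. Then for every fair division instance of goods on these agents in which all agents have additive valuations, there exists an allocation X that is G-uHEF-k; that is, there is a set S ⊆ M of at most k goods with |S ∩ X_i| ≤ 1 for every agent i, such that for every edge (i,j) ∈ E, v_i(X_i) ≥ v_i(X_j \ S) and v_j(X_j) ≥ v_j(X_i \ S). -/
/-- Greedy picking: if the pick at time `t` is made according to the weights `w t`, the goods of `s`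
can be ranked by injective picking times so that, at every time `t` up to the time at which `g` is
picked, the good picked is worth at least as much as `g` under `w t`. -/
theorem exists_greedy_ranking {M : Type*} [DecidableEq M] (s : Finset M) (w : ℕ → M → ℝ) :
    ∃ r : M → ℕ, Set.InjOn r s ∧
      ∀ g ∈ s, ∀ t ≤ r g, ∃ h ∈ s, r h = t ∧ w t g ≤ w t h := by
  induction hn : s.card generalizing s w with
  | zero =>
    rw [Finset.card_eq_zero] at hn
    subst hn
    exact ⟨fun _ => 0, by simp, by simp⟩
  | succ n ih =>
    have hne : s.Nonempty := Finset.card_pos.mp (by omega)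
    obtain ⟨b, hb, hmax⟩ := s.exists_max_image (w 0) hne
    obtain ⟨r, hinj, hr⟩ := ih (s.erase b) (fun t => w (t + 1))
      (by rw [Finset.card_erase_of_mem hb]; omega)
    refine ⟨fun g => if g = b then 0 else r g + 1, ?_, ?_⟩
    · intro x hx y hy hxy
      by_cases hxb : x = b <;> by_cases hyb : y = b
      · rw [hxb, hyb]
      · simp [hxb, hyb] at hxy
      · simp [hxb, hyb] at hxy
      · simp only [hxb, hyb, if_false, Nat.add_right_cancel_iff] at hxy
        exact hinj (by simpa [hxb] using hx) (by simpa [hyb] using hy) hxy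
    · intro g hg t ht
      rcases t with _ | t
      · exact ⟨b, hb, by simp, hmax g hg⟩
      · by_cases hgb : g = b
        · simp [hgb] at ht
        · simp only [hgb, if_false, Nat.add_le_add_iff_right] at ht
          obtain ⟨h, hh, hrh, hle⟩ := hr g (Finset.mem_erase.mpr ⟨hgb, hg⟩) t ht
          rw [Finset.mem_erase] at hh
          exact ⟨h, hh.2, by simp [hh.1, hrh], hle⟩

/-- A sum of weights is bounded by another one as soon as every good of the first bundle is matched,
injectively through a shift of picking times by `d`, to a better good of the second bundle. -/
theorem sum_le_sum_of_time_shift {M : Type*} [DecidableEq M] {A B : Finset M} {v : M → ℝ}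
    (hv : ∀ g, 0 ≤ v g) {r : M → ℕ} (hr : Function.Injective r) (d : ℕ)
    (h : ∀ g ∈ A, d ≤ r g ∧ ∃ b ∈ B, r b = r g - d ∧ v g ≤ v b) :
    ∑ g ∈ A, v g ≤ ∑ g ∈ B, v g := by
  choose! hd f hfB hfr hfv using h
  have hinj : Set.InjOn f A := by
    intro x hx y hy hxy
    apply hr
    have h1 := hfr x hx
    have h2 := hfr y hy
    have h3 := hd x hx
    have h4 := hd y hy
    rw [hxy] at h1
    omega
  calc ∑ g ∈ A, v g ≤ ∑ g ∈ A, v (f g) := Finset.sum_le_sum hfv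
    _ = ∑ g ∈ A.image f, v g := (Finset.sum_image hinj).symm
    _ ≤ ∑ g ∈ B, v g := by
      refine Finset.sum_le_sum_of_subset_of_nonneg ?_ fun g _ _ => hv g
      exact Finset.image_subset_iff.mpr hfB

/-- Going back from a time `t` of residue `q` to an earlier time of residue `p`. -/
theorem exists_shift_to_residue {n k p q : ℕ} (hp : p < n)
    (hk : q < k ∨ p < q) :
    ∃ d, ∀ t, t % n = q → k ≤ t → d ≤ t ∧ (t - d) % n = p := by
  refine ⟨if p < q then q - p else n + q - p, fun t ht hkt => ?_⟩
  have hdiv := Nat.mod_add_div t n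
  rw [ht] at hdiv
  split_ifs with hlt
  · refine ⟨by omega, ?_⟩
    rw [show t - (q - p) = p + n * (t / n) by omega, Nat.add_mul_mod_self_left,
      Nat.mod_eq_of_lt hp]
  · obtain ⟨m, hm⟩ : ∃ m, t / n = m + 1 := by
      refine Nat.exists_eq_succ_of_ne_zero fun h0 => ?_
      rw [h0] at hdiv
      omega
    rw [hm, mul_add, mul_one] at hdiv
    refine ⟨by omega, ?_⟩
    rw [show t - (n + q - p) = p + n * m by omega, Nat.add_mul_mod_self_left,
      Nat.mod_eq_of_lt hp]

/-- Every finite set `A` can be enumerated cyclically so that a given subset `C` comes first. -/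
theorem exists_cyclic_enumeration {N : Type*} [DecidableEq N] {A C : Finset N} (hCA : C ⊆ A)
    (hA : A.Nonempty) :
    ∃ (a : ℕ → N) (pos : N → ℕ), (∀ t, a t ∈ A) ∧
      (∀ i ∈ A, pos i < A.card ∧ ∀ t, a t = i ↔ t % A.card = pos i) ∧
      ∀ i ∈ A, i ∈ C ↔ pos i < C.card := by
  set l := C.toList ++ (A \ C).toList with hl
  have hlen : l.length = A.card := by
    rw [hl, List.length_append, Finset.length_toList, Finset.length_toList,
      add_comm, Finset.card_sdiff_add_card_eq_card hCA]
  have hmem : ∀ i, i ∈ l ↔ i ∈ A := by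
    intro i
    simp only [hl, List.mem_append, Finset.mem_toList, Finset.mem_sdiff]
    have := @hCA i
    tauto
  have hnodup : l.Nodup := by
    rw [hl, List.nodup_append']
    refine ⟨C.nodup_toList, (A \ C).nodup_toList, fun i hi hi' => ?_⟩
    simp only [Finset.mem_toList, Finset.mem_sdiff] at hi hi'
    exact hi'.2 hi
  have hmod : ∀ t, t % A.card < l.length := fun t => by
    rw [hlen]; exact Nat.mod_lt _ hA.card_pos
  refine ⟨fun t => l[t % A.card]'(hmod t), fun i => l.idxOf i,
    fun t => (hmem _).mp (List.getElem_mem _), fun i hi => ?_, fun i hi => ?_⟩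
  · have hlt : l.idxOf i < l.length := List.idxOf_lt_length_iff.mpr ((hmem i).mpr hi)
    refine ⟨hlen ▸ hlt, fun t => ⟨fun h => ?_, fun h => ?_⟩⟩
    · subst h
      exact (hnodup.idxOf_getElem _ _).symm
    · simp [h]
  · by_cases hiC : i ∈ C
    · simp only [hiC, true_iff, hl]
      rw [List.idxOf_append_of_mem (by simpa using hiC), ← Finset.length_toList]
      exact List.idxOf_lt_length_iff.mpr (by simpa using hiC)
    · simp only [hiC, false_iff, hl, not_lt]
      rw [List.idxOf_append_of_notMem (by simpa using hiC), Finset.length_toList]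
      omega

/-- If some connected component of the graph `G` has a vertex
cover `C` of size `k`, then every fair division instance of goods with additive
valuations (given by per-good values `val i g ≥ 0`) admits a `G`-uHEF-`k`
allocation: a partition `X` of the goods together with a hidden set `S` of at
most `k` goods, at most one hidden per bundle, such that along every edge of
`G` no agent envies the other's bundle once `S` is hidden. -/
theorem stmt0
    {N M : Type*} [Fintype N] [Fintype M] [DecidableEq N] [DecidableEq M]
    (G : SimpleGraph N)
    (c : G.ConnectedComponent) (C : Finset N) (k : ℕ)
    (hCcomp : ∀ i ∈ C, G.connectedComponentMk i = c)
    (hCcover : ∀ i j : N, G.Adj i j → G.connectedComponentMk i = c →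
      i ∈ C ∨ j ∈ C)
    (hCk : C.card = k)
    (val : N → M → ℝ) (hval : ∀ i g, 0 ≤ val i g) :
    ∃ X : N → Finset M,
      (∀ i j, i ≠ j → Disjoint (X i) (X j)) ∧
      (∀ g : M, ∃ i, g ∈ X i) ∧
      ∃ S : Finset M, S.card ≤ k ∧ (∀ i, (S ∩ X i).card ≤ 1) ∧
        ∀ i j : N, G.Adj i j →
          (∑ g ∈ X j \ S, val i g) ≤ ∑ g ∈ X i, val i g := by
  classical
  subst hCk
  set A : Finset N := Finset.univ.filter fun i => G.connectedComponentMk i = c with hAdef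
  have hmemA : ∀ i, i ∈ A ↔ G.connectedComponentMk i = c := by simp [hAdef]
  have hCA : C ⊆ A := fun i hi => (hmemA i).mpr (hCcomp i hi)
  have hA : A.Nonempty := by
    obtain ⟨i, hi⟩ := c.exists_rep
    exact ⟨i, (hmemA i).mpr hi⟩
  obtain ⟨a, pos, haA, hpos, hposC⟩ := exists_cyclic_enumeration hCA hA
  obtain ⟨r, hinj, hr⟩ := exists_greedy_ranking (Finset.univ : Finset M) fun t => val (a t)
  rw [Finset.coe_univ, Set.injOn_univ] at hinj
  have hCcard : C.card ≤ A.card := Finset.card_le_card hCA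
  refine ⟨fun i => Finset.univ.filter fun g => a (r g) = i, ?_, fun g => ⟨a (r g), by simp⟩,
    Finset.univ.filter fun g => r g < C.card, ?_, ?_, ?_⟩
  · intro i j hij
    rw [Finset.disjoint_left]
    intro g hgi hgj
    simp only [Finset.mem_filter, Finset.mem_univ, true_and] at hgi hgj
    exact hij (hgi.symm.trans hgj)
  · calc _ ≤ (Finset.range C.card).card :=
          Finset.card_le_card_of_injOn r (by intro g hg; simpa using hg) hinj.injOn
      _ = C.card := Finset.card_range _
  · intro i
    rw [Finset.card_le_one]
    intro g hg h hh
    simp only [Finset.mem_inter, Finset.mem_filter, Finset.mem_univ, true_and] at hg hh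
    have hi : i ∈ A := hg.2 ▸ haA _
    have h1 := ((hpos i hi).2 _).mp hg.2
    have h2 := ((hpos i hi).2 _).mp hh.2
    rw [Nat.mod_eq_of_lt (by omega)] at h1 h2
    exact hinj (h1.trans h2.symm)
  · intro i j hij
    by_cases hj : j ∈ A
    · have hi : i ∈ A := by
        rw [hmemA] at hj ⊢
        rw [← hj]
        exact SimpleGraph.ConnectedComponent.sound hij.reachable
      obtain ⟨hpi, hai⟩ := hpos i hi
      have haj := (hpos j hj).2
      have hcov : pos j < C.card ∨ pos i < pos j := by
        have := hCcover i j hij ((hmemA i).mp hi)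
        rw [hposC i hi, hposC j hj] at this
        omega
      obtain ⟨d, hd⟩ := exists_shift_to_residue hpi hcov
      refine sum_le_sum_of_time_shift (hval i) hinj d fun g hg => ?_
      simp only [Finset.mem_sdiff, Finset.mem_filter, Finset.mem_univ, true_and, not_lt] at hg
      obtain ⟨hdg, hmod⟩ := hd (r g) ((haj _).mp hg.1) hg.2
      obtain ⟨b, -, hrb, hle⟩ := hr g (Finset.mem_univ g) (r g - d) (Nat.sub_le _ _)
      have hab : a (r g - d) = i := (hai _).mpr hmod
      rw [hab] at hle
      exact ⟨hdg, b, by simp [hrb, hab], hrb, hle⟩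
    · rw [Finset.sum_eq_zero fun g hg => ?_]
      · exact Finset.sum_nonneg fun g _ => hval i g
      · simp only [Finset.mem_sdiff, Finset.mem_filter, Finset.mem_univ, true_and] at hg
        exact absurd (hg.1 ▸ haA _) hj
end

section
/- Let G = (N, E) be an undirected graph with connected components G_1, G_2, …, G_u, let C_t be a minimum vertex cover of G_t for each t, and let k = min_{t ∈ [u]} |C_t|. Then there exists a fair division instance of goods on the agents N with additive valuations such that for every k' < k, no allocation of the goods is G-HEF-k'. -/
/-- A finset `C` is a vertex cover of the connected component `t` of `G`:
its members lie in `t` and every edge inside `t` has an endpoint in `C`. -/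
def IsComponentVertexCover {N : Type*} (G : SimpleGraph N)
    (t : G.ConnectedComponent) (C : Finset N) : Prop :=
  (∀ i ∈ C, G.connectedComponentMk i = t) ∧
  (∀ i j : N, G.Adj i j → G.connectedComponentMk i = t → i ∈ C ∨ j ∈ C)

/-- The weights `2 ^ m + 2 ^ g` on `Fin m` are all within a factor two of each other and have
distinct subset sums. -/
def nearUniformWeight (m : ℕ) (g : Fin m) : ℕ := 2 ^ m + 2 ^ (g : ℕ)

lemma sum_nearUniformWeight_injective (m : ℕ) :
    Function.Injective fun A : Finset (Fin m) => ∑ g ∈ A, nearUniformWeight m g := by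
  have split : ∀ A : Finset (Fin m), ∑ g ∈ A, nearUniformWeight m g =
      2 ^ m * A.card + ∑ i ∈ A.map Fin.valEmbedding, 2 ^ i := by
    intro A
    simp [nearUniformWeight, Finset.sum_add_distrib, mul_comm]
  have small : ∀ A : Finset (Fin m), ∑ i ∈ A.map Fin.valEmbedding, 2 ^ i < 2 ^ m := by
    intro A
    refine Nat.geomSum_lt le_rfl fun i hi => ?_
    obtain ⟨g, -, rfl⟩ := Finset.mem_map.1 hi
    exact g.isLt
  intro A B h
  have h' := congrArg (· % 2 ^ m) h
  simp only [split, Nat.mul_add_mod, Nat.mod_eq_of_lt (small _)] at h'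
  exact Finset.map_injective _ (Finset.geomSum_injective le_rfl h')

lemma sum_nearUniformWeight_le (m : ℕ) (A : Finset (Fin m)) :
    ∑ g ∈ A, nearUniformWeight m g ≤ A.card * (2 * 2 ^ m) := by
  refine Finset.sum_le_card_nsmul _ _ _ fun g _ => ?_
  have := Nat.pow_le_pow_right (n := 2) (by norm_num) g.isLt.le
  unfold nearUniformWeight
  omega

lemma le_sum_nearUniformWeight (m : ℕ) (A : Finset (Fin m)) :
    A.card * 2 ^ m ≤ ∑ g ∈ A, nearUniformWeight m g :=
  Finset.card_nsmul_le_sum _ _ _ fun _ _ => Nat.le_add_right _ _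

/-- A function increasing by at most `s` along each edge increases by at most `s * length`
along a walk. -/
lemma SimpleGraph.Walk.le_add_length_mul {N : Type*} {G : SimpleGraph N} {f : N → ℕ} {s : ℕ}
    (hf : ∀ i j, G.Adj i j → f j ≤ f i + s) {i j : N} (p : G.Walk i j) :
    f j ≤ f i + p.length * s := by
  induction p with
  | nil => simp
  | cons h p ih =>
    have := hf _ _ h
    rw [SimpleGraph.Walk.length_cons, add_mul]
    omega

/-- Fewer hidden goods than the size of any vertex cover of the component `t` leave an edge of `t`
neither of whose endpoints owns a hidden good. -/
lemma exists_adj_disjoint_of_card_lt {N α : Type*} [Fintype N] [DecidableEq α]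
    {G : SimpleGraph N} {t : G.ConnectedComponent} {S : Finset α} {X : N → Finset α}
    (hS : ∀ C : Finset N, IsComponentVertexCover G t C → S.card < C.card)
    (hX : ∀ i j, i ≠ j → Disjoint (X i) (X j)) :
    ∃ i j, G.Adj i j ∧ G.connectedComponentMk i = t ∧ Disjoint (X i) S ∧ Disjoint (X j) S := by
  classical
  by_contra! hcon
  let C : Finset N := {i | G.connectedComponentMk i = t ∧ ¬ Disjoint (X i) S}
  have hC : IsComponentVertexCover G t C := by
    refine ⟨fun i hi => (Finset.mem_filter.1 hi).2.1, fun i j hij hi => ?_⟩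
    have hj : G.connectedComponentMk j = t :=
      (SimpleGraph.ConnectedComponent.eq.2 hij.symm.reachable).trans hi
    by_cases hd : Disjoint (X i) S
    · exact .inr (by simp [C, hj, hcon i j hij hi hd])
    · exact .inl (by simp [C, hi, hd])
  refine (hS C hC).not_ge ?_
  have key : ∀ i ∈ C, ∃ g ∈ S, g ∈ X i := by
    intro i hi
    obtain ⟨g, hg, hgS⟩ := Finset.not_disjoint_iff.1 (Finset.mem_filter.1 hi).2.2
    exact ⟨g, hgS, hg⟩
  refine Finset.card_le_card_of_forall_subsingleton (fun i g => g ∈ X i) key ?_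
  intro g _ i hi j hj
  by_contra hne
  exact Finset.disjoint_left.1 (hX i j hne) hi.2 hj.2

/-- Let `k` be the minimum over the connected components of
`G` of the size of a minimum vertex cover of that component.  Then there is a
fair division instance of goods (goods `Fin m`, additive nonnegative
valuations) on the agents such that no allocation is `G`-HEF-`k'` for any
`k' < k`. -/
theorem stmt1 {N : Type*} [Fintype N] [DecidableEq N]
    (G : SimpleGraph N) (k : ℕ)
    (hk_attained : ∃ (t : G.ConnectedComponent) (C : Finset N),
      IsComponentVertexCover G t C ∧ C.card = k)
    (hk_min : ∀ (t : G.ConnectedComponent) (C : Finset N),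
      IsComponentVertexCover G t C → k ≤ C.card) :
    ∃ (m : ℕ) (val : N → Fin m → ℝ),
      (∀ i g, 0 ≤ val i g) ∧
      ∀ k' : ℕ, k' < k →
        ∀ X : N → Finset (Fin m),
          (∀ i j, i ≠ j → Disjoint (X i) (X j)) →
          (∀ g : Fin m, ∃ i, g ∈ X i) →
          ¬ ∃ S : Finset (Fin m), S.card ≤ k' ∧
              ∀ i j : N, G.Adj i j →
                (∑ g ∈ X j \ S, val i g) ≤ ∑ g ∈ X i, val i g := by
  classical
  set n := Fintype.card N
  set m := 2 * (n * n * k) + k + 1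
  refine ⟨m, fun _ g => nearUniformWeight m g, fun _ _ => Nat.cast_nonneg _, ?_⟩
  rintro k' hk' X hX hcover ⟨S, hS, hef⟩
  let v : Finset (Fin m) → ℕ := fun A => ∑ g ∈ A, nearUniformWeight m g
  replace hef : ∀ i j, G.Adj i j → v (X j \ S) ≤ v (X i) := fun i j h => by
    have hij := hef i j h
    beta_reduce at hij
    simp only [v]
    exact_mod_cast hij
  have step : ∀ i j, G.Adj i j → v (X j \ S) ≤ v (X i \ S) + v S := by
    intro i j h
    refine (hef i j h).trans ?_
    have hsub : X i ⊆ (X i \ S) ∪ S := by simp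
    calc v (X i) ≤ v ((X i \ S) ∪ S) := Finset.sum_le_sum_of_subset hsub
      _ = v (X i \ S) + v S := Finset.sum_union Finset.sdiff_disjoint
  have bound : ∀ p, v (X p \ S) ≤ n * v S := by
    intro p
    obtain ⟨i, j, hij, hi, hiS, hjS⟩ := exists_adj_disjoint_of_card_lt
      (t := G.connectedComponentMk p) (S := S)
      (fun C hC => (hS.trans_lt hk').trans_le (hk_min _ C hC)) hX
    have h₁ := hef i j hij
    have h₂ := hef j i hij.symm
    rw [Finset.sdiff_eq_self_of_disjoint hjS] at h₁
    rw [Finset.sdiff_eq_self_of_disjoint hiS] at h₂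
    have heq : X i = X j := sum_nearUniformWeight_injective m (h₂.antisymm h₁)
    have hempty : X i = ∅ := by
      have := hX i j hij.ne
      rwa [← heq, disjoint_self] at this
    obtain ⟨w, hw⟩ := (SimpleGraph.ConnectedComponent.eq.1 hi).exists_isPath
    have := w.le_add_length_mul (f := fun l => v (X l \ S)) step
    have h0 : v (X i \ S) = 0 := by simp [v, hempty]
    simp only [h0, zero_add] at this
    exact this.trans (Nat.mul_le_mul_right _ hw.length_lt.le)
  have total : v Sᶜ ≤ n * (n * v S) := by
    have hsub : Sᶜ ⊆ Finset.univ.biUnion fun p => X p \ S := by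
      intro g hg
      obtain ⟨i, hi⟩ := hcover g
      exact Finset.mem_biUnion.2 ⟨i, Finset.mem_univ _,
        Finset.mem_sdiff.2 ⟨hi, Finset.mem_compl.1 hg⟩⟩
    calc v Sᶜ ≤ v (Finset.univ.biUnion fun p => X p \ S) := Finset.sum_le_sum_of_subset hsub
      _ = ∑ p, v (X p \ S) := Finset.sum_biUnion fun i _ j _ hij =>
          (hX i j hij).mono Finset.sdiff_subset Finset.sdiff_subset
      _ ≤ n * (n * v S) := Finset.sum_le_card_nsmul _ _ _ fun p _ => bound p
  have hScard : S.card ≤ k := hS.trans hk'.le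
  have hcard : 2 * (n * n * k) + 1 ≤ Sᶜ.card := by
    rw [Finset.card_compl, Fintype.card_fin]
    omega
  have hlt : (2 * (n * n * k) + 1) * 2 ^ m ≤ 2 * (n * n * k) * 2 ^ m :=
    calc (2 * (n * n * k) + 1) * 2 ^ m ≤ Sᶜ.card * 2 ^ m := Nat.mul_le_mul_right _ hcard
      _ ≤ v Sᶜ := le_sum_nearUniformWeight m _
      _ ≤ n * (n * v S) := total
      _ ≤ n * (n * (k * (2 * 2 ^ m))) := by
        gcongr
        exact (sum_nearUniformWeight_le m S).trans (Nat.mul_le_mul_right _ hScard)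
      _ = 2 * (n * n * k) * 2 ^ m := by ring
  have := Nat.le_of_mul_le_mul_right hlt (by positivity)
  omega
end

section
/- For every n ≥ 2, there is a fair division instance with n agents and n − 1 goods, in which all agents have identical additive valuations assigning a strictly positive value to each good, such that no allocation is HEF-k for any k < n − 1 (i.e., on the complete graph, eliminating all envy requires hiding all n − 1 goods). -/
/-- For every `n ≥ 2` there is a fair division instance with
`n` agents and `n - 1` goods, all agents having the same additive valuation
with strictly positive value for every good, such that no allocation is
HEF-`k` for any `k < n - 1`: every hidden set `S` witnessing envy-freeness
between all (ordered) pairs of agents must have size at least `n - 1`. -/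
theorem stmt3 (n : ℕ) (hn : 2 ≤ n) :
    ∃ val : Fin (n - 1) → ℝ,
      (∀ g, 0 < val g) ∧
      ∀ X : Fin n → Finset (Fin (n - 1)),
        (∀ i j, i ≠ j → Disjoint (X i) (X j)) →
        (∀ g : Fin (n - 1), ∃ i, g ∈ X i) →
        ∀ k : ℕ, k < n - 1 →
          ¬ ∃ S : Finset (Fin (n - 1)), S.card ≤ k ∧
              ∀ i j : Fin n, i ≠ j →
                (∑ g ∈ X j \ S, val g) ≤ ∑ g ∈ X i, val g := by
  refine ⟨fun _ => 1, fun _ => one_pos, ?_⟩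
  rintro X hdisj hcover k hk ⟨S, hS, henvy⟩
  choose owner howner using hcover
  -- There are fewer goods than agents, so some agent `i` owns nothing.
  obtain ⟨i, hi⟩ : ∃ i, ∀ g, owner g ≠ i := by
    by_contra! hsurj
    have hcard := Fintype.card_le_of_surjective owner hsurj
    simp only [Fintype.card_fin] at hcard
    omega
  have hempty : X i = ∅ := Finset.eq_empty_of_forall_notMem fun g hg =>
    Finset.disjoint_left.mp (hdisj _ _ (hi g)) (howner g) hg
  -- Some good `g` is not hidden, so `i` envies its owner.
  obtain ⟨g, hg⟩ : ∃ g, g ∉ S := by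
    by_contra! hall
    rw [Finset.eq_univ_of_forall hall, Finset.card_fin] at hS
    omega
  have hle := henvy i (owner g) (hi g).symm
  have hpos : (0 : ℝ) < ∑ _g ∈ X (owner g) \ S, 1 :=
    Finset.sum_pos (fun _ _ => one_pos) ⟨g, Finset.mem_sdiff.mpr ⟨howner g, hg⟩⟩
  rw [hempty, Finset.sum_empty] at hle
  exact hpos.not_ge hle
end

section
/- For all n ≥ 1, if G is the star graph K_{1,n−1} on n agents (one central agent adjacent to each of the other n − 1 agents, with no other edges), then for every fair division instance of goods in which all agents have monotone valuations, a G-EFX allocation exists. -/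
/-- A monotone real set function can be refined to a natural-valued rank which is strictly
monotone for inclusion. -/
lemma exists_strictMono_rank {M : Type*} [Fintype M] (w : Finset M → ℝ)
    (hw : Monotone w) :
    ∃ r : Finset M → ℕ, StrictMono r ∧ ∀ S T, w S < w T → r S < r T := by
  classical
  let p : Finset M → ℝ ×ₗ ℕ := fun S => toLex (w S, S.card)
  have key : ∀ S T, p S < p T →
      (Finset.univ.filter fun U => p U < p S).card <
        (Finset.univ.filter fun U => p U < p T).card := by
    intro S T h
    apply Finset.card_lt_card
    rw [Finset.ssubset_iff_of_subset]
    · exact ⟨S, by simpa using h, by simp⟩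
    · intro U hU
      simp only [Finset.mem_filter, Finset.mem_univ, true_and] at hU ⊢
      exact hU.trans h
  refine ⟨fun S => (Finset.univ.filter fun U => p U < p S).card, ?_, ?_⟩
  · intro S T h
    apply key
    rw [Prod.Lex.toLex_lt_toLex]
    rcases (hw h.le).lt_or_eq with h' | h'
    · exact Or.inl h'
    · exact Or.inr ⟨h', Finset.card_lt_card h⟩
  · intro S T h
    apply key
    rw [Prod.Lex.toLex_lt_toLex]
    exact Or.inl h

/-- Agents with a common monotone valuation admit a complete EFX allocation; the allocation is
given as the map sending each good to its owner. -/
lemma exists_efx_of_common_valuation {M ι : Type*} [Fintype M] [DecidableEq M] [Fintype ι]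
    [DecidableEq ι] [Nonempty ι] (w : Finset M → ℝ) (hw : Monotone w) :
    ∃ f : M → ι, ∀ i j, ∀ g ∈ Finset.univ.filter (f · = j),
      w ((Finset.univ.filter (f · = j)).erase g) ≤ w (Finset.univ.filter (f · = i)) := by
  obtain ⟨r, hr, hrw⟩ := exists_strictMono_rank w hw
  let B : (M → ι) → ι → Finset M := fun f i => Finset.univ.filter (f · = i)
  obtain ⟨f, hf⟩ := Finite.exists_min fun f : M → ι => ∑ i, (1 / 2 : ℝ) ^ r (B f i)
  refine ⟨f, fun i j g hg => ?_⟩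
  change g ∈ B f j at hg
  change w ((B f j).erase g) ≤ w (B f i)
  by_contra! hlt
  have hgj : f g = j := by simpa [B] using hg
  have hij : i ≠ j := by
    rintro rfl
    exact hlt.not_ge (hw (Finset.erase_subset _ _))
  have hBi : B (Function.update f g i) i = insert g (B f i) := by
    ext x
    by_cases hx : x = g <;> simp [B, Function.update_apply, hx]
  have hBj : B (Function.update f g i) j = (B f j).erase g := by
    ext x
    by_cases hx : x = g <;> simp [B, Function.update_apply, hx, hij]
  have hBk : ∀ k, k ≠ i → k ≠ j → B (Function.update f g i) k = B f k := by
    intro k hki hkj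
    ext x
    by_cases hx : x = g
    · subst hx
      simp [B, hki.symm, hgj, hkj.symm]
    · simp [B, Function.update_apply, hx]
  have hri : r (B f i) + 1 ≤ r (B (Function.update f g i) i) := by
    rw [hBi]
    exact hr (Finset.ssubset_insert (by simp [B, hgj, hij.symm]))
  have hrj : r (B f i) + 1 ≤ r (B (Function.update f g i) j) := by
    rw [hBj]
    exact hrw _ _ hlt
  have split : ∀ h : ι → ℝ, ∑ k, h k = h i + (h j + ∑ k ∈ (Finset.univ.erase i).erase j, h k) := by
    intro h
    rw [Finset.add_sum_erase _ _ (by simp [hij.symm]), Finset.add_sum_erase _ _ (by simp)]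
  have hrest : ∑ k ∈ (Finset.univ.erase i).erase j, (1 / 2 : ℝ) ^ r (B (Function.update f g i) k) =
      ∑ k ∈ (Finset.univ.erase i).erase j, (1 / 2 : ℝ) ^ r (B f k) := by
    refine Finset.sum_congr rfl fun k hk => ?_
    rw [hBk k (Finset.ne_of_mem_erase (Finset.mem_of_mem_erase hk)) (Finset.ne_of_mem_erase hk)]
  have hmin := hf (Function.update f g i)
  simp only [split, hrest] at hmin
  have half : ∀ m, r (B f i) + 1 ≤ m → (1 / 2 : ℝ) ^ m ≤ (1 / 2) ^ r (B f i) * (1 / 2) := by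
    intro m hm
    rw [← pow_succ]
    exact pow_le_pow_of_le_one (by norm_num) (by norm_num) hm
  have h1 := half _ hri
  have h2 := half _ hrj
  have h3 : (0 : ℝ) < (1 / 2) ^ r (B f j) := by positivity
  linarith

/-- Items can be assigned bijectively so that nobody prefers the item of a fixed agent `c` to
their own. -/
lemma exists_perm_no_envy {ι : Type*} [Fintype ι] [DecidableEq ι] (c : ι) (u : ι → ι → ℝ) :
    ∃ σ : Equiv.Perm ι, ∀ i, u i (σ c) ≤ u i (σ i) := by
  obtain ⟨σ, hσ⟩ := Finite.exists_max fun σ : Equiv.Perm ι =>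
    ∑ i ∈ Finset.univ.erase c, u i (σ i)
  refine ⟨σ, fun i => ?_⟩
  by_cases hic : i = c
  · rw [hic]
  by_contra! hlt
  refine (hσ (Equiv.swap c i |>.trans σ)).not_gt ?_
  apply Finset.sum_lt_sum
  · intro k hk
    have hkc : k ≠ c := Finset.ne_of_mem_erase hk
    by_cases hki : k = i
    · subst hki
      simpa using hlt.le
    · simp [Equiv.swap_apply_of_ne_of_ne hkc hki]
  · exact ⟨i, by simp [hic], by simpa using hlt⟩

/-- For every `n ≥ 1`, if `G` is the star `K_{1,n-1}` on `n`
agents (agent `0` is the center, adjacent exactly to every other agent), then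
every fair division instance of goods with monotone nonnegative valuations
admits a `G`-EFX allocation. -/
theorem stmt6 (n : ℕ) (hn : 1 ≤ n)
    {M : Type*} [Fintype M] [DecidableEq M]
    (v : Fin n → Finset M → ℝ)
    (hv0 : ∀ i, v i ∅ = 0)
    (hvnn : ∀ i S, 0 ≤ v i S)
    (hmono : ∀ i, ∀ S T : Finset M, S ⊆ T → v i S ≤ v i T)
    (G : SimpleGraph (Fin n))
    (hG : ∀ i j : Fin n, G.Adj i j ↔ i ≠ j ∧ (i = ⟨0, hn⟩ ∨ j = ⟨0, hn⟩)) :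
    ∃ X : Fin n → Finset M,
      (∀ i j, i ≠ j → Disjoint (X i) (X j)) ∧
      (∀ g : M, ∃ i, g ∈ X i) ∧
      ∀ i j : Fin n, G.Adj i j → ∀ g ∈ X j, v i ((X j).erase g) ≤ v i (X i) := by
  classical
  let c : Fin n := ⟨0, hn⟩
  have : Nonempty (Fin n) := ⟨c⟩
  obtain ⟨f, hf⟩ := exists_efx_of_common_valuation (ι := Fin n) (v c) fun S T => hmono c S T
  obtain ⟨σ, hσ⟩ := exists_perm_no_envy c fun i k => v i (Finset.univ.filter (f · = k))
  refine ⟨fun i => Finset.univ.filter (f · = σ i), ?_, ?_, ?_⟩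
  · intro i j hij
    rw [Finset.disjoint_left]
    intro g hi hj
    simp only [Finset.mem_filter, Finset.mem_univ, true_and] at hi hj
    exact hij (σ.injective (hi.symm.trans hj))
  · exact fun g => ⟨σ.symm (f g), by simp⟩
  · intro i j hadj g hg
    rcases ((hG i j).1 hadj).2 with rfl | rfl
    · exact hf _ _ g hg
    · exact (hmono i _ _ (Finset.erase_subset _ _)).trans (hσ i)
end

section
/- Suppose there are four agents with monotone valuation functions on a set of goods, two of whom have identical valuations. Then there exists an allocation of the goods to the four agents, and a pair of agents {a, b}, such that for every pair of distinct agents {i, j} other than {a, b}, the EFX condition holds between i and j: for every good g ∈ X_j, v_i(X_i) ≥ v_i(X_j \ {g}), and for every good g ∈ X_i, v_j(X_j) ≥ v_j(X_i \ {g}). -/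
/-- Bundles are compared by value, ties being broken by cardinality. -/
noncomputable def bundleKey {M : Type*} (v : Finset M → ℝ) (S : Finset M) : ℝ ×ₗ ℕ :=
  toLex (v S, S.card)

/-- A bundle weight that drops by a factor of at least three whenever the key increases. -/
noncomputable def bundleWeight {M : Type*} [Fintype M] (v : Finset M → ℝ) (S : Finset M) : ℕ :=
  3 ^ (Finset.univ.filter fun T : Finset M => bundleKey v S < bundleKey v T).card

theorem three_mul_bundleWeight_le {M : Type*} [Fintype M] {v : Finset M → ℝ} {S T : Finset M}
    (h : bundleKey v S < bundleKey v T) : 3 * bundleWeight v T ≤ bundleWeight v S := by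
  unfold bundleWeight
  rw [← pow_succ']
  refine Nat.pow_le_pow_right (by norm_num) (Finset.card_lt_card ?_)
  rw [Finset.ssubset_iff_of_subset]
  · exact ⟨T, by simpa using h, by simp⟩
  · intro U hU
    simp only [Finset.mem_filter, Finset.mem_univ, true_and] at hU ⊢
    exact h.trans hU

/-- Agents sharing a monotone valuation admit a complete EFX allocation. -/
theorem exists_efx_of_identical {M ι : Type*} [Fintype M] [DecidableEq M] [Fintype ι]
    [DecidableEq ι] [Nonempty ι] (v : Finset M → ℝ)
    (hmono : ∀ S T : Finset M, S ⊆ T → v S ≤ v T) :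
    ∃ Y : ι → Finset M, (∀ i j, i ≠ j → Disjoint (Y i) (Y j)) ∧ (∀ g, ∃ i, g ∈ Y i) ∧
      ∀ i j, ∀ g ∈ Y j, v ((Y j).erase g) ≤ v (Y i) := by
  let B : (M → ι) → ι → Finset M := fun c i => Finset.univ.filter fun g => c g = i
  have hB : ∀ c i g, g ∈ B c i ↔ c g = i := by simp [B]
  obtain ⟨c, hc⟩ := Finite.exists_min fun c : M → ι => ∑ i, bundleWeight v (B c i)
  refine ⟨B c, fun i j hij => ?_, fun g => ⟨c g, by simp [hB]⟩, fun i j g hg => ?_⟩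
  · rw [Finset.disjoint_left]
    intro g hi hj
    exact hij (((hB c i g).1 hi).symm.trans ((hB c j g).1 hj))
  by_contra! hlt
  have hij : i ≠ j := by
    rintro rfl
    exact hlt.not_ge (hmono _ _ (Finset.erase_subset _ _))
  have hcg : c g = j := (hB c j g).1 hg
  have hgi : g ∉ B c i := fun h => hij (((hB c i g).1 h).symm.trans hcg)
  let c' := Function.update c g i
  have hi : B c' i = insert g (B c i) := by
    ext x
    by_cases hx : x = g <;> simp [hB, c', hx]
  have hj : B c' j = (B c j).erase g := by
    ext x
    by_cases hx : x = g <;> simp [hB, c', hx, hij]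
  have hother : ∀ k, k ≠ i → k ≠ j → B c' k = B c k := by
    intro k hki hkj
    ext x
    by_cases hx : x = g
    · simp [hB, c', hx, hcg, hki.symm, hkj.symm]
    · simp [hB, c', hx]
  have keyi : bundleKey v (B c i) < bundleKey v (B c' i) := by
    rw [hi, bundleKey, bundleKey, Prod.Lex.toLex_lt_toLex]
    rcases (hmono _ _ (Finset.subset_insert g (B c i))).lt_or_eq with h | h
    · exact Or.inl h
    · exact Or.inr ⟨h, by simp [Finset.card_insert_of_notMem hgi]⟩
  have keyj : bundleKey v (B c i) < bundleKey v (B c' j) := by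
    rw [hj, bundleKey, bundleKey, Prod.Lex.toLex_lt_toLex]
    exact Or.inl hlt
  have split : ∀ f : ι → ℕ,
      ∑ k, f k = f i + (f j + ∑ k ∈ (Finset.univ.erase i).erase j, f k) := by
    intro f
    rw [Finset.add_sum_erase _ f (by simp [hij.symm]), Finset.add_sum_erase _ f (by simp)]
  have hrest : ∑ k ∈ (Finset.univ.erase i).erase j, bundleWeight v (B c' k) =
      ∑ k ∈ (Finset.univ.erase i).erase j, bundleWeight v (B c k) := by
    refine Finset.sum_congr rfl fun k hk => ?_
    simp only [Finset.mem_erase, Finset.mem_univ, and_true] at hk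
    rw [hother k hk.2 hk.1]
  have hmin : ∑ k, bundleWeight v (B c k) ≤ ∑ k, bundleWeight v (B c' k) := hc c'
  rw [split, split, hrest] at hmin
  have h1 := three_mul_bundleWeight_le keyi
  have h2 := three_mul_bundleWeight_le keyj
  have hpos : 0 < bundleWeight v (B c i) := pow_pos (by norm_num) _
  omega

theorem exists_perm_apply_eq_apply_eq {α : Type*} [DecidableEq α] {a b k l : α} (hab : a ≠ b)
    (hkl : k ≠ l) : ∃ σ : Equiv.Perm α, σ a = k ∧ σ b = l := by
  refine ⟨(Equiv.swap a k).trans (Equiv.swap (Equiv.swap a k b) l), ?_, by simp⟩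
  have h : k ≠ Equiv.swap a k b := fun h =>
    hab ((Equiv.swap a k).injective ((Equiv.swap_apply_left a k).trans h))
  simp [Equiv.swap_apply_of_ne_of_ne h hkl]

/-- Four agents with monotone nonnegative valuations, two of
whom (agents `p ≠ q`) have identical valuations.  Then there exist an
allocation `X` and a pair of agents `{a, b}` such that the (two-sided) EFX
condition holds between every pair of distinct agents other than `{a, b}`. -/
theorem stmt8 {M : Type*} [Fintype M] [DecidableEq M]
    (v : Fin 4 → Finset M → ℝ)
    (hv0 : ∀ i, v i ∅ = 0)
    (hvnn : ∀ i S, 0 ≤ v i S)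
    (hmono : ∀ i, ∀ S T : Finset M, S ⊆ T → v i S ≤ v i T)
    (p q : Fin 4) (hpq : p ≠ q) (hsame : v p = v q) :
    ∃ X : Fin 4 → Finset M,
      (∀ i j, i ≠ j → Disjoint (X i) (X j)) ∧
      (∀ g : M, ∃ i, g ∈ X i) ∧
      ∃ a b : Fin 4, a ≠ b ∧
        ∀ i j : Fin 4, i ≠ j → ({i, j} : Finset (Fin 4)) ≠ {a, b} →
          ∀ g ∈ X j, v i ((X j).erase g) ≤ v i (X i) := by
  obtain ⟨Y, hdisj, hcover, hefx⟩ := exists_efx_of_identical (ι := Fin 4) (v p) (hmono p)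
  obtain ⟨a, b, hab, hall⟩ : ∃ a b : Fin 4, a ≠ b ∧ ∀ i, i = p ∨ i = q ∨ i = a ∨ i = b := by
    clear hefx hsame
    revert p q
    decide
  -- Agent `a` chooses first and agent `b` second; `p` and `q` accept any remaining bundle.
  obtain ⟨k, hk⟩ := Finite.exists_max fun i => v a (Y i)
  obtain ⟨l, hl, hlmax⟩ := Finset.exists_max_image (Finset.univ.erase k) (fun i => v b (Y i))
    (by rw [← Finset.card_pos]; simp)
  simp only [Finset.mem_erase, Finset.mem_univ, and_true] at hl hlmax
  obtain ⟨σ, hσa, hσb⟩ := exists_perm_apply_eq_apply_eq hab hl.symm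
  refine ⟨fun i => Y (σ i), fun i j hij => hdisj _ _ (σ.injective.ne hij), fun g => ?_,
    a, b, hab, fun i j hij hpair g hg => ?_⟩
  · obtain ⟨i, hi⟩ := hcover g
    exact ⟨σ.symm i, by simpa using hi⟩
  · beta_reduce
    have herase : v i ((Y (σ j)).erase g) ≤ v i (Y (σ j)) :=
      hmono i _ _ (Finset.erase_subset _ _)
    rcases hall i with rfl | rfl | rfl | rfl
    · exact hefx _ _ g hg
    · exact hsame ▸ hefx (σ i) (σ j) g hg
    · rw [hσa]
      exact herase.trans (hk (σ j))
    · have hja : σ j ≠ k := by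
        rintro rfl
        exact hpair (by rw [σ.injective hσa, Finset.pair_comm])
      rw [hσb]
      exact herase.trans (hlmax (σ j) hja)
end

section
/- Let G = P_4 be the three-edge path on four agents 1 — 2 — 3 — 4. Then for every fair division instance of goods in which the four agents have arbitrary monotone valuations, a G-EFX allocation exists. -/
namespace PathEFX

variable {M : Type*}

/-- Pairwise disjointness of four bundles. -/
structure Disjoint4 (A B C D : Finset M) : Prop where
  ab : Disjoint A B
  ac : Disjoint A C
  ad : Disjoint A D
  bc : Disjoint B C
  bd : Disjoint B D
  cd : Disjoint C D

lemma Disjoint4.mono {A B C D A' B' C' D' : Finset M} (h : Disjoint4 A B C D) (hA : A' ⊆ A)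
    (hB : B' ⊆ B) (hC : C' ⊆ C) (hD : D' ⊆ D) : Disjoint4 A' B' C' D' :=
  ⟨h.ab.mono hA hB, h.ac.mono hA hC, h.ad.mono hA hD, h.bc.mono hB hC, h.bd.mono hB hD,
    h.cd.mono hC hD⟩

lemma Disjoint4.swap_left {A B C D : Finset M} (h : Disjoint4 A B C D) : Disjoint4 B A C D :=
  ⟨h.ab.symm, h.bc, h.bd, h.ac, h.ad, h.cd⟩

lemma Disjoint4.swap_mid {A B C D : Finset M} (h : Disjoint4 A B C D) : Disjoint4 A C B D :=
  ⟨h.ac, h.ab, h.ad, h.bc.symm, h.cd, h.bd⟩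

lemma Disjoint4.swap_right {A B C D : Finset M} (h : Disjoint4 A B C D) : Disjoint4 A B D C :=
  ⟨h.ab, h.ad, h.ac, h.bd, h.bc, h.cd.symm⟩

lemma ne_of_disjoint {w : Finset M → ℕ} (hw : Function.Injective w)
    {b : ℕ} (hb : w ∅ < b) {B C : Finset M} (h : Disjoint B C) (hB : b ≤ w B) : w B ≠ w C := by
  intro hBC
  obtain rfl := hw hBC
  rw [Finset.disjoint_self_iff_empty] at h
  subst h
  omega

lemma exists_max_of_le {β : Type*} (p : β → Prop) (f : β → ℕ) (N : ℕ) (hN : ∀ x, p x → f x ≤ N)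
    (hp : ∃ x, p x) : ∃ x, p x ∧ ∀ y, p y → f y ≤ f x := by
  obtain ⟨x, hx⟩ := hp
  obtain ⟨_, ⟨y, hy, rfl⟩, hmax⟩ := BddAbove.exists_isGreatest_of_nonempty
    (S := Set.image f {x | p x}) ⟨N, by rintro _ ⟨x, hx, rfl⟩; exact hN x hx⟩ ⟨_, x, hx, rfl⟩
  exact ⟨y, hy, fun z hz => hmax ⟨z, hz, rfl⟩⟩

/-- Every monotone valuation is refined by an injective, strictly monotone ranking of the
bundles. -/
lemma exists_ranking [Fintype M] (v : Finset M → ℝ) (hv : ∀ S T, S ⊆ T → v S ≤ v T) :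
    ∃ r : Finset M → ℕ, StrictMono r ∧ Function.Injective r ∧ ∀ S T, r S ≤ r T → v S ≤ v T := by
  classical
  obtain ⟨e⟩ : Nonempty (Finset M ≃ Fin (Fintype.card (Finset M))) := ⟨Fintype.equivFin _⟩
  let key : Finset M → ℝ ×ₗ (ℕ ×ₗ ℕ) := fun S => toLex (v S, toLex (S.card, (e S : ℕ)))
  have hkey_inj : Function.Injective key := fun S T h => by
    simp only [key, EmbeddingLike.apply_eq_iff_eq, Prod.mk.injEq] at h
    exact e.injective (Fin.ext h.2.2)
  have hkey_mono : StrictMono key := fun S T h => by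
    have h₁ := hv S T h.le
    have h₂ := Finset.card_lt_card h
    simp only [key, Prod.Lex.toLex_lt_toLex]
    rcases h₁.lt_or_eq with h₁ | h₁
    · exact Or.inl h₁
    · exact Or.inr ⟨h₁, Or.inl h₂⟩
  let r : Finset M → ℕ := fun S => (Finset.univ.filter fun T => key T < key S).card
  have hr : ∀ S T, key S < key T → r S < r T := fun S T h => by
    refine Finset.card_lt_card (Finset.ssubset_iff_of_subset ?_ |>.2 ⟨S, ?_, ?_⟩)
    · intro X hX
      simp only [Finset.mem_filter, Finset.mem_univ, true_and] at hX ⊢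
      exact hX.trans h
    · simpa using h
    · simp
  refine ⟨r, fun S T h => hr S T (hkey_mono h), fun S T h => ?_, fun S T h => ?_⟩
  · rcases lt_trichotomy (key S) (key T) with h' | h' | h'
    · exact absurd h (hr S T h').ne
    · exact hkey_inj h'
    · exact absurd h (hr T S h').ne'
  · by_contra! h'
    refine absurd h (not_le.2 (hr T S ?_))
    simp only [key, Prod.Lex.toLex_lt_toLex]
    exact Or.inl h'

lemma exists_best_first (f : Finset M → ℝ) (A A' : Finset M) :
    ∃ P Q, f Q ≤ f P ∧ ((P = A ∧ Q = A') ∨ (P = A' ∧ Q = A)) := by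
  rcases le_total (f A') (f A) with h | h
  · exact ⟨A, A', h, Or.inl ⟨rfl, rfl⟩⟩
  · exact ⟨A', A, h, Or.inr ⟨rfl, rfl⟩⟩

variable [DecidableEq M]

/-- No bundle obtained from `X` by removing one good exceeds level `a` under `u`
or level `b` under `w`. -/
def Tight (u w : Finset M → ℕ) (a b : ℕ) (X : Finset M) : Prop :=
  ∀ g ∈ X, u (X.erase g) ≤ a ∧ w (X.erase g) ≤ b

/-- A partial EFX allocation at levels `a` and `b`: `A, A'` go to agents with valuation `u`,
and `B, B'` to agents with valuation `w`. -/
structure Balanced (u w : Finset M → ℕ) (a b : ℕ) (A A' B B' : Finset M) : Prop where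
  disj : Disjoint4 A A' B B'
  tight_A : Tight u w a b A
  tight_A' : Tight u w a b A'
  tight_B : Tight u w a b B
  tight_B' : Tight u w a b B'
  le_A : a ≤ u A
  le_A' : a ≤ u A'
  le_B : b ≤ w B
  le_B' : b ≤ w B'

/-- A partial allocation in which `A` and at least one `Bᵢ` are acceptable under `u`, while all
three `Bᵢ` are acceptable under `w`. -/
structure Tripled (u w : Finset M → ℕ) (a b : ℕ) (A B₁ B₂ B₃ : Finset M) : Prop where
  disj : Disjoint4 A B₁ B₂ B₃
  tight_A : Tight u w a b A
  tight₁ : Tight u w a b B₁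
  tight₂ : Tight u w a b B₂
  tight₃ : Tight u w a b B₃
  le_A : a ≤ u A
  le₁ : b ≤ w B₁
  le₂ : b ≤ w B₂
  le₃ : b ≤ w B₃
  le_u : a ≤ u B₁ ∨ a ≤ u B₂ ∨ a ≤ u B₃

lemma Disjoint4.insert_left {A B C D : Finset M} {g : M} (h : Disjoint4 A B C D)
    (hB : g ∉ B) (hC : g ∉ C) (hD : g ∉ D) : Disjoint4 (insert g A) B C D :=
  ⟨Finset.disjoint_insert_left.2 ⟨hB, h.ab⟩, Finset.disjoint_insert_left.2 ⟨hC, h.ac⟩,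
    Finset.disjoint_insert_left.2 ⟨hD, h.ad⟩, h.bc, h.bd, h.cd⟩

lemma Tight.mono {u w : Finset M → ℕ} {a b a' b' : ℕ} {X : Finset M} (h : Tight u w a b X)
    (ha : a ≤ a') (hb : b ≤ b') : Tight u w a' b' X :=
  fun g hg => ⟨(h g hg).1.trans ha, (h g hg).2.trans hb⟩

lemma Tight.of_le {u w : Finset M → ℕ} (hu : Monotone u) {a b c : ℕ} {X : Finset M}
    (h : Tight u w a b X) (hc : u X ≤ c) : Tight u w c b X :=
  fun g hg => ⟨(hu (Finset.erase_subset g X)).trans hc, (h g hg).2⟩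

lemma Tight.subset {u w : Finset M → ℕ} (hu : Monotone u) (hw : Monotone w) {a b : ℕ}
    {X Y : Finset M} (h : Tight u w a b X) (hY : Y ⊆ X) : Tight u w a b Y :=
  fun g hg => ⟨(hu (Finset.erase_subset_erase g hY)).trans (h g (hY hg)).1,
    (hw (Finset.erase_subset_erase g hY)).trans (h g (hY hg)).2⟩

lemma exists_minimal_subset (p : Finset M → Prop) (X : Finset M) (hX : p X) :
    ∃ S ⊆ X, p S ∧ ∀ g ∈ S, ¬ p (S.erase g) := by
  induction X using Finset.strongInduction with
  | H X ih =>
    by_cases h : ∃ g ∈ X, p (X.erase g)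
    · obtain ⟨g, hg, hp⟩ := h
      obtain ⟨S, hS, h⟩ := ih _ (Finset.erase_ssubset hg) hp
      exact ⟨S, hS.trans (Finset.erase_subset g X), h⟩
    · push Not at h
      exact ⟨X, subset_rfl, hX, h⟩

/-- A bundle that is not tight contains a tight one that exceeds one of the levels. -/
lemma exists_tight_subset {u w : Finset M → ℕ} {a b : ℕ} {X : Finset M}
    (h : ¬ Tight u w a b X) : ∃ S ⊆ X, Tight u w a b S ∧ (a < u S ∨ b < w S) := by
  unfold Tight at h
  push Not at h
  obtain ⟨g, hg, hgX⟩ := h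
  obtain ⟨S, hS, hp, hmin⟩ := exists_minimal_subset (fun S => a < u S ∨ b < w S) (X.erase g)
    (by by_cases h' : u (X.erase g) ≤ a
        · exact Or.inr (hgX h')
        · exact Or.inl (not_le.1 h'))
  refine ⟨S, hS.trans (Finset.erase_subset g X), fun x hx => ?_, hp⟩
  have := hmin x hx
  push Not at this
  exact this

/-- The bundle acceptable to `u` can be trimmed so as to make one of the `Bᵢ` acceptable too. -/
lemma exists_tripled {u w : Finset M → ℕ} (hu : Monotone u) (hw : Monotone w) {a b : ℕ}
    {A B₁ B₂ B₃ : Finset M} (hd : Disjoint4 A B₁ B₂ B₃) (tA : Tight u w a b A)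
    (t₁ : Tight u w a b B₁) (t₂ : Tight u w a b B₂) (t₃ : Tight u w a b B₃) (hA : a ≤ u A)
    (h₁ : b ≤ w B₁) (h₂ : b ≤ w B₂) (h₃ : b ≤ w B₃) :
    ∃ a' A', Tripled u w a' b A' B₁ B₂ B₃ := by
  by_cases h : a ≤ u B₁ ∨ a ≤ u B₂ ∨ a ≤ u B₃
  · exact ⟨a, A, hd, tA, t₁, t₂, t₃, hA, h₁, h₂, h₃, h⟩
  · push Not at h
    obtain ⟨c, hc₁, hc₂, hc₃, hca, hc⟩ : ∃ c, u B₁ ≤ c ∧ u B₂ ≤ c ∧ u B₃ ≤ c ∧ c ≤ a ∧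
        (c ≤ u B₁ ∨ c ≤ u B₂ ∨ c ≤ u B₃) :=
      ⟨max (u B₁) (max (u B₂) (u B₃)), by omega, by omega, by omega, by omega, by omega⟩
    obtain ⟨S, hS, hcS, hmin⟩ := exists_minimal_subset (fun S => c ≤ u S) A (hca.trans hA)
    exact ⟨c, S, hd.mono hS subset_rfl subset_rfl subset_rfl,
      fun g hg => ⟨(not_le.1 (hmin g hg)).le, (tA.subset hu hw hS g hg).2⟩,
      t₁.of_le hu hc₁, t₂.of_le hu hc₂, t₃.of_le hu hc₃, hcS, h₁, h₂, h₃, hc⟩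

lemma Balanced.swap_left {u w : Finset M → ℕ} {a b : ℕ} {A A' B B' : Finset M}
    (h : Balanced u w a b A A' B B') : Balanced u w a b A' A B B' :=
  ⟨h.disj.swap_left, h.tight_A', h.tight_A, h.tight_B, h.tight_B', h.le_A', h.le_A, h.le_B,
    h.le_B'⟩

/-- The levels can be raised as long as the bundles stay acceptable. -/
lemma Balanced.raise {u w : Finset M → ℕ} {a b : ℕ} {A A' B B' : Finset M}
    (h : Balanced u w a b A A' B B') {a' b' : ℕ} (ha : a ≤ a') (hb : b ≤ b') (hA : a' ≤ u A)
    (hA' : a' ≤ u A') (hB : b' ≤ w B) (hB' : b' ≤ w B') : Balanced u w a' b' A A' B B' :=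
  ⟨h.disj, h.tight_A.mono ha hb, h.tight_A'.mono ha hb, h.tight_B.mono ha hb,
    h.tight_B'.mono ha hb, hA, hA', hB, hB'⟩

lemma Tripled.swap_left {u w : Finset M → ℕ} {a b : ℕ} {A B₁ B₂ B₃ : Finset M}
    (h : Tripled u w a b A B₁ B₂ B₃) : Tripled u w a b A B₂ B₁ B₃ :=
  ⟨h.disj.swap_mid, h.tight_A, h.tight₂, h.tight₁, h.tight₃, h.le_A, h.le₂, h.le₁, h.le₃,
    by have := h.le_u; tauto⟩

lemma Tripled.swap_right {u w : Finset M → ℕ} {a b : ℕ} {A B₁ B₂ B₃ : Finset M}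
    (h : Tripled u w a b A B₁ B₂ B₃) : Tripled u w a b A B₁ B₃ B₂ :=
  ⟨h.disj.swap_right, h.tight_A, h.tight₁, h.tight₃, h.tight₂, h.le_A, h.le₁, h.le₃, h.le₂,
    by have := h.le_u; tauto⟩

lemma Tripled.balanced {u w : Finset M → ℕ} {a b : ℕ} {A B₁ B₂ B₃ : Finset M}
    (h : Tripled u w a b A B₁ B₂ B₃) (h₁ : a ≤ u B₁) : Balanced u w a b A B₁ B₂ B₃ :=
  ⟨h.disj, h.tight_A, h.tight₁, h.tight₂, h.tight₃, h.le_A, h₁, h.le₂, h.le₃⟩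

/-- Some reordering of a tripled family is a balanced one. -/
lemma Tripled.exists_balanced {u w : Finset M → ℕ} {a b : ℕ} {A B₁ B₂ B₃ : Finset M}
    (h : Tripled u w a b A B₁ B₂ B₃) :
    Balanced u w a b A B₁ B₂ B₃ ∨ Balanced u w a b A B₂ B₁ B₃ ∨ Balanced u w a b A B₃ B₁ B₂ := by
  rcases h.le_u with h' | h' | h'
  · exact Or.inl (h.balanced h')
  · exact Or.inr (Or.inl (h.swap_left.balanced h'))
  · exact Or.inr (Or.inr (h.swap_right.swap_left.balanced h'))

/-- There is no balanced family whose level for `w` exceeds `b`. -/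
def IsMaxLevel (u w : Finset M → ℕ) (b : ℕ) : Prop :=
  ∀ a b' A A' B B', Balanced u w a b' A A' B B' → b' ≤ b

lemma IsMaxLevel.not_balanced {u w : Finset M → ℕ} {a b : ℕ} (hb : IsMaxLevel u w b)
    {A A' B B' : Finset M} (hB : b < w B) (hB' : b < w B') : ¬ Balanced u w a b A A' B B' :=
  fun h => absurd (hb a (b + 1) A A' B B' (h.raise le_rfl b.le_succ h.le_A h.le_A' hB hB'))
    (by omega)

lemma IsMaxLevel.not_tripled {u w : Finset M → ℕ} {a b : ℕ} (hb : IsMaxLevel u w b)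
    {A B₁ B₂ B₃ : Finset M} (h₁ : b < w B₁) (h₂ : b < w B₂) (h₃ : b < w B₃) :
    ¬ Tripled u w a b A B₁ B₂ B₃ := fun h => by
  rcases h.exists_balanced with h | h | h
  · exact hb.not_balanced h₂ h₃ h
  · exact hb.not_balanced h₁ h₃ h
  · exact hb.not_balanced h₁ h₂ h

/-- An unallocated good can be used to improve a tripled family of maximal level. -/
lemma Tripled.improve {u w : Finset M → ℕ} (hu : StrictMono u) (hw : StrictMono w) {a b : ℕ}
    (hb : IsMaxLevel u w b) {A B₁ B₂ B₃ : Finset M} (h : Tripled u w a b A B₁ B₂ B₃) {g : M}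
    (hA : g ∉ A) (h₁ : g ∉ B₁) (h₂ : g ∉ B₂) (h₃ : g ∉ B₃)
    (hw₂ : w B₁ < w B₂) (hw₃ : w B₁ < w B₃) :
    ∃ C, w B₁ < w C ∧ Tripled u w a b A C B₂ B₃ := by
  have hlt₂ := h.le₁.trans_lt hw₂
  have hlt₃ := h.le₁.trans_lt hw₃
  have hd : Disjoint4 A (insert g B₁) B₂ B₃ := (h.disj.swap_left.insert_left hA h₂ h₃).swap_left
  have hlt := Finset.ssubset_insert h₁
  by_cases ht : Tight u w a b (insert g B₁)
  · exact ⟨_, hw hlt, hd, h.tight_A, ht, h.tight₂, h.tight₃, h.le_A, h.le₁.trans (hw hlt).le,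
      h.le₂, h.le₃, h.le_u.imp_left fun h' => h'.trans (hu hlt).le⟩
  · exfalso
    obtain ⟨S, hS, tS, hexc⟩ := exists_tight_subset ht
    have hdS := hd.mono subset_rfl hS subset_rfl subset_rfl
    rcases hexc with huS | hwS
    · exact hb.not_balanced hlt₂ hlt₃
        ⟨hdS, h.tight_A, tS, h.tight₂, h.tight₃, h.le_A, huS.le, h.le₂, h.le₃⟩
    · obtain ⟨a', A', h'⟩ := exists_tripled hu.monotone hw.monotone hdS h.tight_A tS h.tight₂
        h.tight₃ h.le_A hwS.le h.le₂ h.le₃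
      exact hb.not_tripled hwS hlt₂ hlt₃ h'

/-- An unallocated good can be used to improve a balanced family, or to turn it into a
tripled one. -/
lemma Balanced.improve {u w : Finset M → ℕ} (hu : StrictMono u) (hw : StrictMono w) {a b : ℕ}
    {A A' B B' : Finset M} (h : Balanced u w a b A A' B B') {g : M}
    (hA : g ∉ A) (hA' : g ∉ A') (hB : g ∉ B) (hB' : g ∉ B') (hle : u A ≤ u A') :
    (∃ a' C, u A < u C ∧ Balanced u w a' b C A' B B') ∨
      ∃ a' C B₁ B₂ B₃, Tripled u w a' b C B₁ B₂ B₃ := by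
  replace h := h.raise h.le_A le_rfl le_rfl hle h.le_B h.le_B'
  have hd := h.disj.insert_left hA' hB hB'
  have hlt := Finset.ssubset_insert hA
  by_cases ht : Tight u w (u A) b (insert g A)
  · exact Or.inl ⟨u A, _, hu hlt, hd, ht, h.tight_A', h.tight_B, h.tight_B',
      (hu hlt).le, h.le_A', h.le_B, h.le_B'⟩
  · obtain ⟨S, hS, tS, hexc⟩ := exists_tight_subset ht
    have hdS := hd.mono hS subset_rfl subset_rfl subset_rfl
    rcases hexc with huS | hwS
    · exact Or.inl ⟨u A, S, huS, hdS, tS, h.tight_A', h.tight_B, h.tight_B', huS.le,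
        h.le_A', h.le_B, h.le_B'⟩
    · obtain ⟨a', C, h'⟩ := exists_tripled hu.monotone hw.monotone hdS.swap_left h.tight_A' tS
        h.tight_B h.tight_B' h.le_A' hwS.le h.le_B h.le_B'
      exact Or.inr ⟨a', C, S, B, B', h'⟩

lemma exists_balanced_of_card [Fintype M] (hM : 4 ≤ Fintype.card M) {u w : Finset M → ℕ}
    (hu : Monotone u) (hw : StrictMono w) :
    ∃ a b A A' B B', w ∅ < b ∧ Balanced u w a b A A' B B' := by
  obtain ⟨f⟩ : Nonempty (Fin 4 ↪ M) := Function.Embedding.nonempty_of_card_le (by simpa using hM)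
  have hd : ∀ i j, i ≠ j → Disjoint ({f i} : Finset M) {f j} := fun i j hij => by
    simpa using hij
  have hlt : ∀ i, w ∅ < w {f i} := fun i => hw (by simp)
  have ht : ∀ i, Tight u w (u ∅) (w ∅ + 1) {f i} := fun i g hg => by
    obtain rfl := Finset.mem_singleton.1 hg
    simp
  exact ⟨u ∅, w ∅ + 1, {f 0}, {f 1}, {f 2}, {f 3}, Nat.lt_succ_self _,
    ⟨hd _ _ (by decide), hd _ _ (by decide), hd _ _ (by decide), hd _ _ (by decide),
      hd _ _ (by decide), hd _ _ (by decide)⟩, ht 0, ht 1, ht 2, ht 3,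
    hu (by simp), hu (by simp), hlt 2, hlt 3⟩

lemma exists_isMaxLevel [Fintype M] (hM : 4 ≤ Fintype.card M) {u w : Finset M → ℕ}
    (hu : Monotone u) (hw : StrictMono w) :
    ∃ b, w ∅ < b ∧ IsMaxLevel u w b ∧ ∃ a A A' B B', Balanced u w a b A A' B B' := by
  obtain ⟨a₀, b₀, A₀, A₀', B₀, B₀', hb₀, h₀⟩ := exists_balanced_of_card hM hu hw
  obtain ⟨b, h, hmax⟩ := exists_max_of_le
    (fun b => ∃ a A A' B B', Balanced u w a b A A' B B') id (w Finset.univ)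
    (by rintro b ⟨a, A, A', B, B', h⟩
        exact h.le_B.trans (hw.monotone (Finset.subset_univ B)))
    ⟨b₀, a₀, A₀, A₀', B₀, B₀', h₀⟩
  exact ⟨b, hb₀.trans_le (hmax b₀ ⟨a₀, A₀, A₀', B₀, B₀', h₀⟩),
    fun a b' A A' B B' h' => hmax b' ⟨a, A, A', B, B', h'⟩, h⟩

/-- A tripled family of maximal level yields a complete balanced family. -/
lemma Tripled.exists_complete [Fintype M] {u w : Finset M → ℕ} (hu : StrictMono u)
    (hw : StrictMono w) (hwi : Function.Injective w) {a b : ℕ} (hb₀ : w ∅ < b)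
    (hb : IsMaxLevel u w b) {A B₁ B₂ B₃ : Finset M} (h : Tripled u w a b A B₁ B₂ B₃) :
    ∃ a b A A' B B', Balanced u w a b A A' B B' ∧ ∀ g, g ∈ A ∨ g ∈ A' ∨ g ∈ B ∨ g ∈ B' := by
  have hbd : ∀ X, w X ≤ w Finset.univ := fun X => hw.monotone (Finset.subset_univ X)
  obtain ⟨⟨B₁, B₂, B₃⟩, ⟨a, A, h⟩, hmax⟩ := exists_max_of_le
    (fun X : Finset M × Finset M × Finset M => ∃ a A, Tripled u w a b A X.1 X.2.1 X.2.2)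
    (fun X => w X.1 + w X.2.1 + w X.2.2) (3 * w Finset.univ)
    (fun X _ => by
      have := hbd X.1
      have := hbd X.2.1
      have := hbd X.2.2
      omega)
    ⟨(B₁, B₂, B₃), a, A, h⟩
  dsimp only at h
  have hcov : ∀ g, g ∈ A ∨ g ∈ B₁ ∨ g ∈ B₂ ∨ g ∈ B₃ := by
    intro g
    by_contra! hg
    obtain ⟨hA, h₁, h₂, h₃⟩ := hg
    have n₁₂ := ne_of_disjoint hwi hb₀ h.disj.bc h.le₁
    have n₁₃ := ne_of_disjoint hwi hb₀ h.disj.bd h.le₁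
    have n₂₃ := ne_of_disjoint hwi hb₀ h.disj.cd h.le₂
    have hcases : (w B₁ < w B₂ ∧ w B₁ < w B₃) ∨ (w B₂ < w B₁ ∧ w B₂ < w B₃) ∨
        (w B₃ < w B₁ ∧ w B₃ < w B₂) := by omega
    rcases hcases with ⟨l, l'⟩ | ⟨l, l'⟩ | ⟨l, l'⟩
    · obtain ⟨C, hC, h'⟩ := h.improve hu hw hb hA h₁ h₂ h₃ l l'
      have := hmax (C, B₂, B₃) ⟨a, A, h'⟩
      dsimp only at this
      omega
    · obtain ⟨C, hC, h'⟩ := h.swap_left.improve hu hw hb hA h₂ h₁ h₃ l l'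
      have := hmax (C, B₁, B₃) ⟨a, A, h'⟩
      dsimp only at this
      omega
    · obtain ⟨C, hC, h'⟩ := h.swap_right.swap_left.improve hu hw hb hA h₃ h₁ h₂ l l'
      have := hmax (C, B₁, B₂) ⟨a, A, h'⟩
      dsimp only at this
      omega
  rcases h.exists_balanced with h' | h' | h'
  · exact ⟨_, _, _, _, _, _, h', hcov⟩
  · exact ⟨_, _, _, _, _, _, h', fun g => by have := hcov g; tauto⟩
  · exact ⟨_, _, _, _, _, _, h', fun g => by have := hcov g; tauto⟩

/-- Four agents, two with valuation `u` and two with valuation `w`, have a complete EFX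
allocation. -/
lemma exists_complete_balanced [Fintype M] (hM : 4 ≤ Fintype.card M) {u w : Finset M → ℕ}
    (hu : StrictMono u) (hw : StrictMono w) (hwi : Function.Injective w) :
    ∃ a b A A' B B', Balanced u w a b A A' B B' ∧ ∀ g, g ∈ A ∨ g ∈ A' ∨ g ∈ B ∨ g ∈ B' := by
  obtain ⟨b, hb₀, hb, a, A, A', B, B', h⟩ := exists_isMaxLevel hM hu.monotone hw
  by_cases htri : ∃ a A B₁ B₂ B₃, Tripled u w a b A B₁ B₂ B₃
  · obtain ⟨a, A, B₁, B₂, B₃, h⟩ := htri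
    exact h.exists_complete hu hw hwi hb₀ hb
  have hbd : ∀ X, u X ≤ u Finset.univ := fun X => hu.monotone (Finset.subset_univ X)
  obtain ⟨⟨A, A'⟩, ⟨a, B, B', h⟩, hmax⟩ := exists_max_of_le
    (fun X : Finset M × Finset M => ∃ a B B', Balanced u w a b X.1 X.2 B B')
    (fun X => u X.1 + u X.2) (2 * u Finset.univ)
    (fun X _ => by
      have := hbd X.1
      have := hbd X.2
      omega)
    ⟨(A, A'), a, B, B', h⟩
  dsimp only at h
  refine ⟨a, b, A, A', B, B', h, fun g => ?_⟩
  by_contra! hg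
  obtain ⟨hA, hA', hB, hB'⟩ := hg
  rcases le_total (u A) (u A') with hle | hle
  · obtain ⟨a', C, hC, h'⟩ := (h.improve hu hw hA hA' hB hB' hle).resolve_right htri
    have := hmax (C, A') ⟨a', B, B', h'⟩
    dsimp only at this
    omega
  · obtain ⟨a', C, hC, h'⟩ := (h.swap_left.improve hu hw hA' hA hB hB' hle).resolve_right htri
    have := hmax (C, A) ⟨a', B, B', h'⟩
    dsimp only at this
    omega

/-- With two copies each of two monotone valuations on at least four goods, a complete EFX
allocation exists: `A, A'` for the first and `B, B'` for the second valuation. -/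
lemma exists_efx_two_valuations [Fintype M] (hM : 4 ≤ Fintype.card M) (v v' : Finset M → ℝ)
    (hv : ∀ S T, S ⊆ T → v S ≤ v T) (hv' : ∀ S T, S ⊆ T → v' S ≤ v' T) :
    ∃ A A' B B' : Finset M, Disjoint4 A A' B B' ∧
      (∀ g, g ∈ A ∨ g ∈ A' ∨ g ∈ B ∨ g ∈ B') ∧
      ∀ Y, (Y = A ∨ Y = A' ∨ Y = B ∨ Y = B') → ∀ g ∈ Y,
        v (Y.erase g) ≤ v A ∧ v (Y.erase g) ≤ v A' ∧
        v' (Y.erase g) ≤ v' B ∧ v' (Y.erase g) ≤ v' B' := by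
  obtain ⟨u, hu, -, huv⟩ := exists_ranking v hv
  obtain ⟨w, hw, hwi, hwv⟩ := exists_ranking v' hv'
  obtain ⟨a, b, A, A', B, B', h, hcov⟩ := exists_complete_balanced hM hu hw hwi
  refine ⟨A, A', B, B', h.disj, hcov, fun Y hY g hg => ?_⟩
  have ht : Tight u w a b Y := by
    rcases hY with rfl | rfl | rfl | rfl
    exacts [h.tight_A, h.tight_A', h.tight_B, h.tight_B']
  obtain ⟨h₁, h₂⟩ := ht g hg
  exact ⟨huv _ _ (h₁.trans h.le_A), huv _ _ (h₁.trans h.le_A'), hwv _ _ (h₂.trans h.le_B),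
    hwv _ _ (h₂.trans h.le_B')⟩

end PathEFX

/-- If `G` is the three-edge path `P₄` on four agents
`0 — 1 — 2 — 3`, then every fair division instance of goods in which the four
agents have arbitrary monotone nonnegative valuations admits a `G`-EFX
allocation. -/
theorem stmt10 {M : Type*} [Fintype M] [DecidableEq M]
    (v : Fin 4 → Finset M → ℝ)
    (hv0 : ∀ i, v i ∅ = 0)
    (hvnn : ∀ i S, 0 ≤ v i S)
    (hmono : ∀ i, ∀ S T : Finset M, S ⊆ T → v i S ≤ v i T)
    (G : SimpleGraph (Fin 4))
    (hG : ∀ i j : Fin 4, G.Adj i j ↔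
      ((i = 0 ∧ j = 1) ∨ (i = 1 ∧ j = 0) ∨
       (i = 1 ∧ j = 2) ∨ (i = 2 ∧ j = 1) ∨
       (i = 2 ∧ j = 3) ∨ (i = 3 ∧ j = 2))) :
    ∃ X : Fin 4 → Finset M,
      (∀ i j, i ≠ j → Disjoint (X i) (X j)) ∧
      (∀ g : M, ∃ i, g ∈ X i) ∧
      ∀ i j : Fin 4, G.Adj i j → ∀ g ∈ X j, v i ((X j).erase g) ≤ v i (X i) := by
  rcases lt_or_ge (Fintype.card M) 4 with hM | hM
  · obtain ⟨f⟩ : Nonempty (M ↪ Fin 4) :=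
      Function.Embedding.nonempty_of_card_le (by simpa using hM.le)
    refine ⟨fun i => Finset.univ.filter fun g => f g = i, fun i j hij => ?_,
      fun g => ⟨f g, by simp⟩, fun i j _ g hg => ?_⟩
    · rw [Finset.disjoint_left]
      intro g hg hg'
      simp only [Finset.mem_filter, Finset.mem_univ, true_and] at hg hg'
      exact hij (hg.symm.trans hg')
    · have : (Finset.univ.filter fun g => f g = j).erase g = ∅ := by
        ext x
        simp only [Finset.mem_filter, Finset.mem_univ, true_and] at hg
        simp only [Finset.mem_erase, Finset.mem_filter, Finset.mem_univ, true_and,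
          Finset.notMem_empty, iff_false, not_and]
        exact fun hx h => hx (f.injective (h.trans hg.symm))
      rw [this, hv0]
      exact hvnn _ _
  · obtain ⟨A, A', B, B', hd, hcov, hefx⟩ :=
      PathEFX.exists_efx_two_valuations hM (v 1) (v 2) (hmono 1) (hmono 2)
    obtain ⟨P, Q, hPQ, hP⟩ := PathEFX.exists_best_first (v 0) A A'
    obtain ⟨R, S, hRS, hR⟩ := PathEFX.exists_best_first (v 3) B B'
    have hd' : PathEFX.Disjoint4 P Q S R := by
      rcases hP with ⟨rfl, rfl⟩ | ⟨rfl, rfl⟩ <;> rcases hR with ⟨rfl, rfl⟩ | ⟨rfl, rfl⟩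
      exacts [hd.swap_right, hd, hd.swap_left.swap_right, hd.swap_left]
    have hcov' : ∀ g, g ∈ P ∨ g ∈ Q ∨ g ∈ S ∨ g ∈ R := fun g => by
      have := hcov g
      rcases hP with ⟨rfl, rfl⟩ | ⟨rfl, rfl⟩ <;> rcases hR with ⟨rfl, rfl⟩ | ⟨rfl, rfl⟩ <;> tauto
    have hefx' : ∀ Y, (Y = P ∨ Y = Q ∨ Y = S ∨ Y = R) → ∀ g ∈ Y,
        v 1 (Y.erase g) ≤ v 1 Q ∧ v 2 (Y.erase g) ≤ v 2 S := fun Y hY g hg => by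
      have := hefx Y (by
        rcases hP with ⟨rfl, rfl⟩ | ⟨rfl, rfl⟩ <;> rcases hR with ⟨rfl, rfl⟩ | ⟨rfl, rfl⟩ <;>
          tauto) g hg
      rcases hP with ⟨rfl, rfl⟩ | ⟨rfl, rfl⟩ <;> rcases hR with ⟨rfl, rfl⟩ | ⟨rfl, rfl⟩ <;> tauto
    refine ⟨![P, Q, S, R], fun i j hij => ?_, fun g => ?_, fun i j hij g hg => ?_⟩
    · fin_cases i <;> fin_cases j <;> first
        | exact absurd rfl hij
        | exact hd'.ab
        | exact hd'.ac
        | exact hd'.ad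
        | exact hd'.bc
        | exact hd'.bd
        | exact hd'.cd
        | exact hd'.ab.symm
        | exact hd'.ac.symm
        | exact hd'.ad.symm
        | exact hd'.bc.symm
        | exact hd'.bd.symm
        | exact hd'.cd.symm
    · rcases hcov' g with h | h | h | h
      exacts [⟨0, h⟩, ⟨1, h⟩, ⟨2, h⟩, ⟨3, h⟩]
    · rcases (hG i j).1 hij with ⟨rfl, rfl⟩ | ⟨rfl, rfl⟩ | ⟨rfl, rfl⟩ | ⟨rfl, rfl⟩ | ⟨rfl, rfl⟩ |
        ⟨rfl, rfl⟩
      · exact (hmono 0 _ _ (Finset.erase_subset g Q)).trans hPQ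
      · exact (hefx' P (by tauto) g hg).1
      · exact (hefx' S (by tauto) g hg).1
      · exact (hefx' Q (by tauto) g hg).2
      · exact (hefx' R (by tauto) g hg).2
      · exact (hmono 3 _ _ (Finset.erase_subset g S)).trans hRS
end

section
/- Let G = (N, E) be a connected undirected graph containing two vertices u and v with graph distance dist_G(u, v) ≥ 4 (in particular, any connected graph of diameter at least 4). Then for every instance with a set M of items partitioned into goods M⁺ and chores M⁻, in which every agent has a lexicographic preference over bundles, there exists a G-EFX allocation of all items. -/
/-- Lexicographic strict preference over bundles induced by a priority ranking
`rank` (lower rank = higher priority, injective) and a set `goods` of goods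
(items outside `goods` are chores): `A` is strictly preferred to `B` iff the
highest-priority item `o` of the symmetric difference `A △ B` is a good lying
in `A`, or a chore not lying in `A`. -/
def LexPrefers {M : Type*} [DecidableEq M] (goods : Finset M) (rank : M → ℕ)
    (A B : Finset M) : Prop :=
  ∃ o ∈ (A \ B) ∪ (B \ A),
    (∀ o' ∈ (A \ B) ∪ (B \ A), rank o ≤ rank o') ∧
    ((o ∈ goods ∧ o ∈ A) ∨ (o ∉ goods ∧ o ∉ A))

/-- Sequential picking: every agent of `S` takes at most one item of `B` and the rest goes to `u`,
so that each agent of `S` weakly prefers (in rank) her own item to every item left to `u`. -/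
theorem exists_picking {N M : Type*} [DecidableEq M] (u : N) (S : Finset N) (hu : u ∉ S)
    (B : Finset M) (rank : N → M → ℕ) :
    ∃ f : M → N, (∀ o, f o = u ∨ f o ∈ S) ∧
      (∀ o ∈ B, ∀ o' ∈ B, f o = f o' → f o ∈ S → o = o') ∧
      ∀ i ∈ S, ∀ r ∈ B, f r = u → ∃ h ∈ B, f h = i ∧ rank i h ≤ rank i r := by
  classical
  induction S using Finset.induction_on with
  | empty => exact ⟨fun _ => u, by simp⟩
  | insert a S ha ih =>
    rw [Finset.mem_insert, not_or] at hu
    obtain ⟨f, hf, hinj, hpref⟩ := ih hu.2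
    by_cases hR : (B.filter fun o => f o = u).Nonempty
    · obtain ⟨h, hh, hmin⟩ := Finset.exists_min_image _ (rank a) hR
      simp only [Finset.mem_filter] at hh hmin
      refine ⟨Function.update f h a, ?_, ?_, ?_⟩
      · intro o
        have := hf o
        grind
      · intro o ho o' ho'
        have h1 := hinj o ho o' ho'
        have h2 := hf o
        have h3 := hf o'
        grind
      · intro i hi r hr hfr
        have hfru : f r = u := by grind
        rcases Finset.mem_insert.1 hi with rfl | hi
        · exact ⟨h, hh.1, by simp, hmin r ⟨hr, hfru⟩⟩
        · obtain ⟨k, hk, hki, hle⟩ := hpref i hi r hr hfru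
          exact ⟨k, hk, by grind, hle⟩
    · have hne : ∀ o ∈ B, f o ≠ u := by
        intro o ho hou
        exact hR ⟨o, Finset.mem_filter.2 ⟨ho, hou⟩⟩
      refine ⟨f, ?_, ?_, ?_⟩
      · intro o
        have := hf o
        grind
      · intro o ho o' ho' heq _
        exact hinj o ho o' ho' heq ((hf o).resolve_left (hne o ho))
      · intro i _ r hr hru
        exact absurd hru (hne r hr)

/-- Closed neighbourhoods of vertices at distance at least `4` are disjoint and not joined by an
edge. -/
theorem SimpleGraph.not_adj_of_four_le_dist {N : Type*} {G : SimpleGraph N} (hconn : G.Connected)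
    {u v : N} (hdist : 4 ≤ G.dist u v) {i j : N} (hi : i = u ∨ G.Adj u i)
    (hj : j = v ∨ G.Adj v j) : i ≠ j ∧ ¬ G.Adj i j := by
  have hle : ∀ {x y : N}, y = x ∨ G.Adj x y → G.dist x y ≤ 1 := by
    rintro x y (rfl | h)
    · simp
    · exact (SimpleGraph.dist_eq_one_iff_adj.2 h).le
  have h1 := hle hi
  have h2 := hle hj
  have h3 := hconn.dist_triangle (u := u) (v := i) (w := v)
  have h4 := hconn.dist_triangle (u := i) (v := j) (w := v)
  rw [SimpleGraph.dist_comm (u := j)] at h4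
  have key : ¬ (j = i ∨ G.Adj i j) := by
    intro h
    have := hle h
    omega
  exact ⟨fun h => key (Or.inl h.symm), fun h => key (Or.inr h)⟩

/-- Let `G` be a connected graph containing two vertices
`u, v` at distance at least `4`.  Then every instance with items partitioned
into goods and chores, where each agent has a lexicographic preference (given
by an injective priority ranking), admits a `G`-EFX allocation of all items:
along every edge `(i, j)`, agent `i` does not strictly prefer `X j` minus any
single good to `X i`, nor `X j` to `X i` minus any single chore of `X i`. -/
theorem stmt14 {N M : Type*} [Fintype N] [DecidableEq N] [Fintype M] [DecidableEq M]
    (G : SimpleGraph N) (hconn : G.Connected)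
    (u v : N) (hdist : 4 ≤ G.dist u v)
    (goods : Finset M)
    (rank : N → M → ℕ)
    (hrank : ∀ i : N, Function.Injective (rank i)) :
    ∃ X : N → Finset M,
      (∀ i j, i ≠ j → Disjoint (X i) (X j)) ∧
      (∀ o : M, ∃ i, o ∈ X i) ∧
      ∀ i j : N, G.Adj i j →
        (∀ g ∈ X j, g ∈ goods →
          ¬ LexPrefers goods (rank i) ((X j).erase g) (X i)) ∧
        (∀ c ∈ X i, c ∉ goods →
          ¬ LexPrefers goods (rank i) (X j) ((X i).erase c)) := by
  classical
  obtain ⟨f, hf, hfinj, hfpref⟩ := exists_picking u (Finset.univ.filter fun i => G.Adj u i)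
    (by simp) goods rank
  obtain ⟨k, hk, hkinj, hkpref⟩ := exists_picking v (Finset.univ.filter fun i => G.Adj v i)
    (by simp) goodsᶜ (fun _ => rank v)
  simp only [Finset.mem_filter, Finset.mem_univ, true_and] at hf hfinj hfpref
  simp only [Finset.mem_filter, Finset.mem_univ, true_and, Finset.mem_compl] at hk hkinj hkpref
  have far := fun {i j : N} => SimpleGraph.not_adj_of_four_le_dist (i := i) (j := j) hconn hdist
  let X : N → Finset M := fun i => Finset.univ.filter fun o => (if o ∈ goods then f o else k o) = i
  have hX : ∀ {i o}, o ∈ X i ↔ (if o ∈ goods then f o else k o) = i := by simp [X]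
  have hgood : ∀ {i o}, o ∈ X i → o ∈ goods → f o = i := by
    intro i o ho hg
    simpa [hX, hg] using ho
  have hchore : ∀ {i o}, o ∈ X i → o ∉ goods → k o = i := by
    intro i o ho hg
    simpa [hX, hg] using ho
  refine ⟨X, ?_, fun o => ⟨_, hX.2 rfl⟩, ?_⟩
  · intro i j hij
    rw [Finset.disjoint_left]
    intro o hi hj
    exact hij ((hX.1 hi).symm.trans (hX.1 hj))
  intro i j hadj
  constructor
  · rintro g hgj hg ⟨o, ho, hmin, hcase⟩
    have hj : j = u ∨ G.Adj u j := hgood hgj hg ▸ hf g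
    have hall : ∀ x, x ∈ X i ∨ x ∈ X j → x ∈ goods := by
      intro x hx
      by_contra hxg
      rcases hx with hx | hx
      · exact (far hj (hchore hx hxg ▸ hk x)).2 hadj.symm
      · exact (far hj (hchore hx hxg ▸ hk x)).1 rfl
    have hog : o ∈ goods := hall o (by grind)
    have hoA : o ∈ (X j).erase g := by grind
    have hoi : o ∉ X i := by grind
    obtain ⟨hne, hoj⟩ := Finset.mem_erase.1 hoA
    have hju : j = u := hj.resolve_right fun h =>
      hne (hfinj o hog g hg ((hgood hoj hog).trans (hgood hgj hg).symm) ((hgood hoj hog).symm ▸ h))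
    subst hju
    obtain ⟨h, hh, hfh, hle⟩ := hfpref i hadj.symm o hog (hgood hoj hog)
    have hhi : h ∈ X i := by simp [hX, hh, hfh]
    have hhj : h ∉ X j := fun hc => hadj.ne (hfh.symm.trans (hgood hc hh))
    have hle' := hmin h (by grind)
    exact hoi (hrank i (le_antisymm hle hle') ▸ hhi)
  · rintro c hci hc ⟨o, ho, hmin, hcase⟩
    have hi : i = v ∨ G.Adj v i := hchore hci hc ▸ hk c
    have hall : ∀ x, x ∈ X i ∨ x ∈ X j → x ∉ goods := by
      intro x hx hxg
      rcases hx with hx | hx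
      · exact (far (hgood hx hxg ▸ hf x) hi).1 rfl
      · exact (far (hgood hx hxg ▸ hf x) hi).2 hadj.symm
    have hog : o ∉ goods := hall o (by grind)
    have hoj : o ∉ X j := by grind
    have hoA : o ∈ (X i).erase c := by grind
    obtain ⟨hne, hoi⟩ := Finset.mem_erase.1 hoA
    have hiv : i = v := hi.resolve_right fun h =>
      hne (hkinj o hog c hc ((hchore hoi hog).trans (hchore hci hc).symm)
        ((hchore hoi hog).symm ▸ h))
    subst hiv
    obtain ⟨h, hh, hkh, hle⟩ := hkpref j hadj o hog (hchore hoi hog)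
    have hhj : h ∈ X j := by simp [hX, hh, hkh]
    have hhi : h ∉ X i := fun hc' => hadj.ne ((hchore hc' hh).symm.trans hkh)
    have hle' := hmin h (by grind)
    exact hoj (hrank i (le_antisymm hle hle') ▸ hhj)
end

section
/- There exists a fair division instance with 3 agents and 3 goods, with additive valuations, together with an allocation giving exactly one good to each agent, that is EFX (with respect to all pairs of agents) but is not uHEF-2: no set S of at most 2 goods with at most one good hidden per bundle eliminates all envy. -/
/-- There is a fair division instance with 3 agents and 3
goods, additive nonnegative valuations, and an allocation giving exactly one
good to each agent, which is EFX between all ordered pairs of agents but is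
not uHEF-2: no set `S` of at most two goods with at most one hidden good per
bundle eliminates all envy. -/
theorem stmt15 :
    ∃ (val : Fin 3 → Fin 3 → ℝ) (X : Fin 3 → Finset (Fin 3)),
      (∀ i g, 0 ≤ val i g) ∧
      (∀ i j, i ≠ j → Disjoint (X i) (X j)) ∧
      (∀ g : Fin 3, ∃ i, g ∈ X i) ∧
      (∀ i, (X i).card = 1) ∧
      (∀ i j : Fin 3, i ≠ j → ∀ g ∈ X j,
        (∑ h ∈ (X j).erase g, val i h) ≤ ∑ h ∈ X i, val i h) ∧
      ¬ ∃ S : Finset (Fin 3), S.card ≤ 2 ∧ (∀ i, (S ∩ X i).card ≤ 1) ∧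
          ∀ i j : Fin 3, i ≠ j →
            (∑ g ∈ X j \ S, val i g) ≤ ∑ g ∈ X i, val i g := by
  refine ⟨fun i g => if g = i then 0 else 1, fun i => {i}, ?_, ?_, ?_, ?_, ?_, ?_⟩
  · intro i g
    positivity
  · intro i j hij
    simpa using hij
  · simp
  · simp
  · intro i j _ g hg
    obtain rfl := Finset.mem_singleton.mp hg
    simp
  · rintro ⟨S, hcard, -, henvy⟩
    obtain ⟨g, hg⟩ : ∃ g, g ∉ S := by
      by_contra! hall
      rw [Finset.eq_univ_of_forall hall] at hcard
      simp at hcard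
    have hne : g ≠ g + 1 := by simp
    have hle := henvy (g + 1) g hne.symm
    rw [Finset.sdiff_eq_self_of_disjoint (Finset.disjoint_singleton_left.mpr hg)] at hle
    simp only [Finset.sum_singleton, if_neg hne, if_true] at hle
    exact absurd hle (by norm_num)
end
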